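/- Let x₁,…,x_N ∈ ℝ³ be distinct points, let m_i > 0, ρ_i > 0, P_i ∈ ℝ and h_i ∈ ℝ for each i, and let k : ℝ × ℝ → ℝ be any function. Define G(i,j,h) = k(|x_i − x_j|, h)(x_i − x_j) ∈ ℝ³ for i ≠ j and G(i,i,h) = 0. Then Σ_{i=1}^N Σ_{j=1}^N (m_i m_j/(ρ_i ρ_j)) x_i × [ P_i G(i,j,h_i) + P_j G(i,j,h_j) ] = 0. Consequently, the SPH equations of motion with a symmetric (radial) kernel explicitly conserve the total angular momentum Σ_i m_i x_i × v_i. -/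

import Mathlib

open scoped BigOperators

/-- The cross product on `ℝ³ = EuclideanSpace ℝ (Fin 3)`. -/
noncomputable def cross3 (a b : EuclideanSpace ℝ (Fin 3)) : EuclideanSpace ℝ (Fin 3) :=
  (WithLp.equiv 2 (Fin 3 → ℝ)).symm
    (crossProduct ((WithLp.equiv 2 (Fin 3 → ℝ)) a) ((WithLp.equiv 2 (Fin 3 → ℝ)) b))

/-- The cross product on `EuclideanSpace ℝ (Fin 3)` as a bilinear map. -/
noncomputable def crossBilin :
    EuclideanSpace ℝ (Fin 3) →ₗ[ℝ] EuclideanSpace ℝ (Fin 3) →ₗ[ℝ] EuclideanSpace ℝ (Fin 3) :=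
  LinearMap.mk₂ ℝ cross3
    (fun a b c => by simp [cross3])
    (fun r a b => by simp [cross3])
    (fun a b c => by simp [cross3])
    (fun r a b => by simp [cross3])

theorem crossBilin_apply (a b : EuclideanSpace ℝ (Fin 3)) : crossBilin a b = cross3 a b := rfl

theorem cross3_self (a : EuclideanSpace ℝ (Fin 3)) : cross3 a a = 0 := by
  simp [cross3]

theorem HasDerivAt.cross3 {f g : ℝ → EuclideanSpace ℝ (Fin 3)}
    {f' g' : EuclideanSpace ℝ (Fin 3)} {t : ℝ} (hf : HasDerivAt f f' t)
    (hg : HasDerivAt g g' t) :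
    HasDerivAt (fun s => cross3 (f s) (g s)) (cross3 (f t) g' + cross3 f' (g t)) t :=
  crossBilin.toContinuousBilinearMap.hasDerivAt_of_bilinear (fun _ => hf) (fun _ => hg)

/-- Pairwise central forces with symmetric coefficients exert no total torque. -/
theorem sum_cross3_central_eq_zero {ι : Type*} [Fintype ι]
    (x : ι → EuclideanSpace ℝ (Fin 3)) (c : ι → ι → ℝ) (hc : ∀ i j, c i j = c j i) :
    ∑ i, ∑ j, cross3 (x i) (c i j • (x i - x j)) = 0 := by
  have hT : ∀ i j, cross3 (x i) (c i j • (x i - x j)) =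
      -cross3 (x j) (c j i • (x j - x i)) := by
    intro i j
    rw [hc j i, eq_neg_iff_add_eq_zero, ← neg_sub (x i) (x j), smul_neg]
    simp only [← crossBilin_apply, map_smul, map_neg]
    rw [← sub_eq_add_neg, ← smul_sub, ← LinearMap.sub_apply, ← map_sub, crossBilin_apply,
      cross3_self, smul_zero]
  have : IsAddTorsionFree (EuclideanSpace ℝ (Fin 3)) := .of_isTorsionFree ℝ _
  rw [← self_eq_neg]
  conv_lhs => rw [Finset.sum_comm]
  simp only [← Finset.sum_neg_distrib]
  exact Finset.sum_congr rfl fun i _ => Finset.sum_congr rfl fun j _ => hT j i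

/-- For distinct particle positions `x i ∈ ℝ³`, masses `m i > 0`,
densities `ρ i > 0`, pressures `P i`, smoothing-lengths `h i`, and any kernel-gradient
factor `k : ℝ × ℝ → ℝ`, with `G i j h = k (‖x i - x j‖, h) • (x i - x j)` for `i ≠ j`
and `G i i h = 0`, the double sum
`∑ i, ∑ j, (m i * m j / (ρ i * ρ j)) • (x i × (P i • G i j (h i) + P j • G i j (h j))) = 0`;
consequently, the SPH equations of motion with a symmetric (radial) kernel explicitly
conserve the total angular momentum `∑ i, m i • (x i × v i)`. -/
theorem stmt5 (N : ℕ) (x : Fin N → EuclideanSpace ℝ (Fin 3))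
    (hx : Function.Injective x)
    (m ρ P h : Fin N → ℝ) (hm : ∀ i, 0 < m i) (hρ : ∀ i, 0 < ρ i)
    (k : ℝ × ℝ → ℝ) (G : Fin N → Fin N → ℝ → EuclideanSpace ℝ (Fin 3))
    (hG : ∀ i j s, i ≠ j → G i j s = k (‖x i - x j‖, s) • (x i - x j))
    (hGdiag : ∀ i s, G i i s = 0) :
    (∑ i, ∑ j, (m i * m j / (ρ i * ρ j)) •
        cross3 (x i) (P i • G i j (h i) + P j • G i j (h j))) = 0 ∧
    ∀ (pos vel : Fin N → ℝ → EuclideanSpace ℝ (Fin 3))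
      (v a : Fin N → EuclideanSpace ℝ (Fin 3)) (t : ℝ),
      (∀ i, pos i t = x i) → (∀ i, vel i t = v i) →
      (∀ i, HasDerivAt (pos i) (v i) t) →
      (∀ i, HasDerivAt (vel i) (a i) t) →
      (∀ i, a i = -(ρ i)⁻¹ •
        ∑ j, (m j / ρ j) • (P i • G i j (h i) + P j • G i j (h j))) →
      HasDerivAt (fun s => ∑ i, m i • cross3 (pos i s) (vel i s)) 0 t := by
  have torque : (∑ i, ∑ j, (m i * m j / (ρ i * ρ j)) •
      cross3 (x i) (P i • G i j (h i) + P j • G i j (h j))) = 0 := by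
    rw [← sum_cross3_central_eq_zero x (fun i j => (m i * m j / (ρ i * ρ j)) *
      (P i * k (‖x i - x j‖, h i) + P j * k (‖x i - x j‖, h j)))
      (fun i j => by rw [norm_sub_rev]; ring)]
    refine Finset.sum_congr rfl fun i _ => Finset.sum_congr rfl fun j _ => ?_
    have hG' : ∀ s, G i j s = k (‖x i - x j‖, s) • (x i - x j) := by
      intro s
      rcases eq_or_ne i j with rfl | hij
      · simp [hGdiag]
      · exact hG i j s hij
    rw [hG', hG', smul_smul, smul_smul, ← add_smul, mul_smul]
    simp only [← crossBilin_apply, map_smul]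
  refine ⟨torque, fun pos vel v a t hpos hvel hdpos hdvel ha => ?_⟩
  have hd := HasDerivAt.fun_sum (u := Finset.univ) fun i _ =>
    ((hdpos i).cross3 (hdvel i)).const_smul (m i)
  refine hd.congr_deriv ?_
  rw [← neg_eq_zero, ← torque, ← Finset.sum_neg_distrib]
  refine Finset.sum_congr rfl fun i _ => ?_
  rw [hpos, hvel, cross3_self, add_zero, ha]
  simp only [← crossBilin_apply, map_smul, map_sum, Finset.smul_sum, ← Finset.sum_neg_distrib]
  refine Finset.sum_congr rfl fun j _ => ?_
  rw [smul_smul, smul_smul, ← neg_smul]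
  congr 1
  field_simp
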